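/- Let b > 1, r > 1, and n ∈ ℕ. There exists a unique pair (x,p) ∈ Ξ_n × Π_n such that δ_x^p minimizes the d_r-distance to the Benford measure β_b over all probability measures supported on at most n points, and the support of this minimizer has exactly n points. -/

import Mathlib

open MeasureTheory Filter Set

noncomputable section

namespace BenfordApprox

/-- Right-hand limit `f₊` of a nondecreasing `f : ℝ → ℝ̄`, at an extended-real point. -/
def fplus (f : ℝ → EReal) (a : EReal) : EReal := sInf (f '' {x : ℝ | a < (x : EReal)})

/-- Left-hand limit `f₋` of a nondecreasing `f : ℝ → ℝ̄`, at an extended-real point. -/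
def fminus (f : ℝ → EReal) (a : EReal) : EReal := sSup (f '' {x : ℝ | (x : EReal) < a})

/-- The (upper) inverse function `f⁻¹(t) = sup {x : f x ≤ t}` (with `sup ∅ = ⊥`). -/
def upperInv (f : ℝ → EReal) (t : ℝ) : EReal :=
  sSup ((fun x : ℝ => (x : EReal)) '' {x : ℝ | f x ≤ (t : EReal)})

/-- The upper inverse, for an extended-real argument. -/
def upperInvE (f : ℝ → EReal) (t : EReal) : EReal :=
  sSup ((fun x : ℝ => (x : EReal)) '' {x : ℝ | f x ≤ t})

/-- Lévy-type distance `d_L(f,g)` between nondecreasing functions `f g : ℝ → ℝ̄`. -/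
def dLfun (f g : ℝ → EReal) : EReal :=
  sInf ((fun y : ℝ => (y : EReal)) ''
    {y : ℝ | 0 ≤ y ∧ ∀ x : ℝ, f (x - y) - (y : EReal) ≤ g x ∧ g x ≤ f (x + y) + (y : EReal)})

/-- The auxiliary function `ℓ_{f,I}`; it depends on `I` only through `lo = inf I`, `hi = sup I`. -/
def ell (f : ℝ → EReal) (lo hi : EReal) (x : ℝ) : ℝ :=
  sInf {y : ℝ | 0 ≤ y ∧ fminus f (hi - (y : EReal)) - (y : EReal) ≤ (x : EReal) ∧
    (x : EReal) ≤ fplus f (lo + (y : EReal)) + (y : EReal)}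

/-- The minimal value `ℓ*_{f,I} = min {y ≥ 0 : f₋(sup I − y) − y ≤ f₊(inf I + y) + y}`. -/
def ellStar (f : ℝ → EReal) (lo hi : EReal) : ℝ :=
  sInf {y : ℝ | 0 ≤ y ∧
    fminus f (hi - (y : EReal)) - (y : EReal) ≤ fplus f (lo + (y : EReal)) + (y : EReal)}

/-- Distribution function `F_μ(t) = μ {y ∈ 𝕀 : y ≤ t}` of `μ`, where `𝕀 = [A,B]`. -/
def cdf (μ : Measure ℝ) (A B : ℝ) (t : ℝ) : ℝ := (μ (Icc A B ∩ Iic t)).toReal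

/-- `F_μ` evaluated at an extended-real point (so `F_μ(−∞) = 0`, `F_μ(+∞) = 1`). -/
def cdfE (μ : Measure ℝ) (A B : ℝ) (a : EReal) : ℝ :=
  (μ (Icc A B ∩ {y : ℝ | (y : EReal) ≤ a})).toReal

/-- Left limit `F_{μ−}` at an extended-real point (so `F_{μ−}(−∞) = 0`, `F_{μ−}(+∞) = 1`). -/
def cdfL (μ : Measure ℝ) (A B : ℝ) (a : EReal) : ℝ :=
  sSup ((cdf μ A B) '' {t : ℝ | (t : EReal) < a})

/-- Left limit `F_{μ−}` at a real point. -/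
def cdfm (μ : Measure ℝ) (A B : ℝ) (t : ℝ) : ℝ := sSup ((cdf μ A B) '' Iio t)

/-- The (upper) quantile function `F_μ⁻¹` of `μ` on `𝕀 = [A,B]`, extended monotonically to `ℝ`. -/
def quant (μ : Measure ℝ) (A B : ℝ) (t : ℝ) : ℝ :=
  if t < (μ {A}).toReal ∨ t < 0 then A
  else sSup {y ∈ Icc A B | cdf μ A B y ≤ t}

/-- Left limit `F⁻¹_{μ−}` of the quantile function. -/
def quantm (μ : Measure ℝ) (A B : ℝ) (t : ℝ) : ℝ := sSup ((quant μ A B) '' Iio t)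

/-- `F_μ` as a function into the extended reals. -/
def cdfEReal (μ : Measure ℝ) (A B : ℝ) : ℝ → EReal := fun t => ((cdf μ A B t : ℝ) : EReal)

/-- `F_μ⁻¹` as a function into the extended reals. -/
def quantEReal (μ : Measure ℝ) (A B : ℝ) : ℝ → EReal := fun t => ((quant μ A B t : ℝ) : EReal)

/-- The finitely supported measure `δ_x^p = Σ_j p_j δ_{x_j}`. -/
def discr (n : ℕ) (x p : Fin n → ℝ) : Measure ℝ :=
  ∑ j : Fin n, ENNReal.ofReal (p j) • Measure.dirac (x j)

/-- `p ∈ Π_n`: a probability vector. -/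
def IsPi (n : ℕ) (p : Fin n → ℝ) : Prop := (∀ j, 0 ≤ p j) ∧ ∑ j, p j = 1

/-- `x ∈ Ξ_n`: a nondecreasing vector of locations in `𝕀 = [A,B]`. -/
def IsXi (A B : ℝ) (n : ℕ) (x : Fin n → ℝ) : Prop := (∀ j, x j ∈ Icc A B) ∧ Monotone x

/-- The uniform weight vector `u_n = (1/n, …, 1/n)`. -/
def unif (n : ℕ) : Fin n → ℝ := fun _ => 1 / (n : ℝ)

/-- Partial sums `P_i = Σ_{j<i} p_j` (so `P_0 = 0`, `P_n = 1`). -/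
def psum (n : ℕ) (p : Fin n → ℝ) (i : ℕ) : ℝ := ∑ j : Fin n, if (j : ℕ) < i then p j else 0

/-- Locations extended by `x_0 = −∞`, `x_{n+1} = +∞`; here `extPts n x j` is the paper's `x_j`. -/
def extPts (n : ℕ) (x : Fin n → ℝ) : ℕ → EReal := fun j =>
  if hj : j = 0 then ⊥ else if h : j ≤ n then ((x ⟨j - 1, by omega⟩ : ℝ) : EReal) else ⊤

/-- `xcoord n x j` is the paper's `x_{j+1}` (0-based access). -/
def xcoord (n : ℕ) (x : Fin n → ℝ) (j : ℕ) : ℝ := if h : j < n then x ⟨j, h⟩ else 0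

/-- The normalizing constant `ω = max{1, λ(𝕀)}/λ(𝕀)` for `𝕀 = [A,B]`. -/
def omegaI (A B : ℝ) : ℝ := max 1 (B - A) / (B - A)

/-- Lévy distance between Borel measures on `𝕀 = [A,B]`. -/
def dLevy (A B : ℝ) (μ ν : Measure ℝ) : ℝ :=
  omegaI A B * sInf {y : ℝ | 0 ≤ y ∧
    ∀ t : ℝ, cdf μ A B (t - y) - y ≤ cdf ν A B t ∧ cdf ν A B t ≤ cdf μ A B (t + y) + y}

/-- Kolmogorov (uniform) distance between Borel measures on `𝕀 = [A,B]`. -/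
def dKol (A B : ℝ) (μ ν : Measure ℝ) : ℝ :=
  sSup (Set.range fun t : ℝ => |cdf μ A B t - cdf ν A B t|)

/-- `L¹`-Kantorovich distance between Borel measures on `𝕀 = [A,B]`. -/
def dKant1 (A B : ℝ) (μ ν : Measure ℝ) : ℝ :=
  (B - A)⁻¹ * ∫ y in Ioo (0 : ℝ) 1, |quant μ A B y - quant ν A B y|

/-- `L^r`-Kantorovich distance between Borel measures on `𝕀 = [A,B]`. -/
def dKant (A B r : ℝ) (μ ν : Measure ℝ) : ℝ :=
  (B - A)⁻¹ * (∫ y in Ioo (0 : ℝ) 1, |quant μ A B y - quant ν A B y| ^ r) ^ (1 / r)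

/-- The Benford measure `β_b` on `[1,b]`: the law of `b^U` with `U` uniform on `[0,1)`. -/
def benford (b : ℝ) : Measure ℝ := (volume.restrict (Ico (0 : ℝ) 1)).map (fun t : ℝ => b ^ t)

/-- The map `T_{f,a}(x) = f₊(f⁻¹(x+a) + 2a) + a`. -/
def Tmap (f : ℝ → EReal) (a : ℝ) : EReal → EReal :=
  fun x => fplus f (upperInvE f (x + (a : EReal)) + ((2 * a : ℝ) : EReal)) + (a : EReal)

/-- The map `S_{f,a}(x) = f₊(f⁻¹(x+a)) + a`. -/
def Smap (f : ℝ → EReal) (a : ℝ) : EReal → EReal :=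
  fun x => fplus f (upperInvE f (x + (a : EReal))) + (a : EReal)

/-- `L_•^{•,n} = min {a ≥ 0 : T_{F_μ,a}^{[n]}(0) ≥ 1}`. -/
def LBB (μ : Measure ℝ) (A B : ℝ) (n : ℕ) : ℝ :=
  sInf {a : ℝ | 0 ≤ a ∧ (1 : EReal) ≤ (Tmap (cdfEReal μ A B) a)^[n] ((0 : ℝ) : EReal)}

/-- `K_•^{•,n} = min {a ≥ 0 : S_{F_μ,a}^{[n]}(0) ≥ 1}`. -/
def KBB (μ : Measure ℝ) (A B : ℝ) (n : ℕ) : ℝ :=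
  sInf {a : ℝ | 0 ≤ a ∧ (1 : EReal) ≤ (Smap (cdfEReal μ A B) a)^[n] ((0 : ℝ) : EReal)}


/-- The odd extension `u ↦ sign u * |u| ^ (r - 1)` of the power function. -/
def signedPow (r u : ℝ) : ℝ := (max u 0) ^ (r - 1) - (max (-u) 0) ^ (r - 1)

lemma continuous_signedPow {r : ℝ} (hr : 1 < r) : Continuous (signedPow r) := by
  unfold signedPow
  exact ((continuous_id.max continuous_const).rpow_const fun _ => Or.inr (by linarith)).sub
    ((continuous_neg.max continuous_const).rpow_const fun _ => Or.inr (by linarith))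

lemma signedPow_strictMono {r : ℝ} (hr : 1 < r) : StrictMono (signedPow r) := by
  refine strictMono_of_odd_strictMonoOn_nonneg (fun u => by simp [signedPow]) ?_
  intro u hu v hv huv
  have h : ∀ w : ℝ, 0 ≤ w → signedPow r w = w ^ (r - 1) := fun w hw => by
    rw [signedPow, max_eq_left hw, max_eq_right (by linarith), Real.zero_rpow (by linarith),
      sub_zero]
  rw [h u hu, h v hv]
  exact Real.rpow_lt_rpow hu huv (by linarith)

lemma signedPow_zero (r : ℝ) : signedPow r 0 = 0 := by simp [signedPow]

lemma signedPow_mul {r c : ℝ} (hc : 0 < c) (u : ℝ) :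
    signedPow r (c * u) = c ^ (r - 1) * signedPow r u := by
  have h1 : max (c * u) 0 = c * max u 0 := by rw [mul_max_of_nonneg _ _ hc.le, mul_zero]
  have h2 : max (-(c * u)) 0 = c * max (-u) 0 := by
    rw [mul_max_of_nonneg _ _ hc.le, mul_zero, mul_neg]
  rw [signedPow, h1, h2, Real.mul_rpow hc.le (le_max_right _ _),
    Real.mul_rpow hc.le (le_max_right _ _), signedPow, mul_sub]

lemma hasDerivAt_abs_rpow_signedPow {r : ℝ} (hr : 1 < r) (u : ℝ) :
    HasDerivAt (fun x : ℝ => |x| ^ r) (r * signedPow r u) u := by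
  convert hasDerivAt_abs_rpow u hr using 1
  rw [mul_assoc]
  congr 1
  rcases lt_trichotomy u 0 with hu | rfl | hu
  · rw [signedPow, max_eq_right hu.le, max_eq_left (by linarith), Real.zero_rpow (by linarith),
      abs_of_neg hu, show r - 1 = (r - 2) + 1 by ring, Real.rpow_add_one (by linarith)]
    ring
  · simp [signedPow]
  · rw [signedPow, max_eq_left hu.le, max_eq_right (by linarith), Real.zero_rpow (by linarith),
      abs_of_pos hu, show r - 1 = (r - 2) + 1 by ring, Real.rpow_add_one (by linarith)]
    ring

lemma continuous_signedPow_sub {b r : ℝ} (hb : 1 < b) (hr : 1 < r) (x : ℝ) :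
    Continuous fun t : ℝ => signedPow r (b ^ t - x) :=
  (continuous_signedPow hr).comp
    ((Real.continuous_const_rpow (by linarith)).sub continuous_const)

lemma continuous_abs_sub_rpow {b r : ℝ} (hb : 1 < b) (hr : 1 < r) (x : ℝ) :
    Continuous fun t : ℝ => |b ^ t - x| ^ r :=
  ((Real.continuous_const_rpow (by linarith)).sub continuous_const).abs.rpow_const
    fun _ => Or.inr (by linarith)

/-- `x` is the `L^r`-center of the exponential `t ↦ b ^ t` on the nondegenerate interval `[a, c]`,
expressed through the first-order condition. -/
def IsCenter (b r a c x : ℝ) : Prop := a < c ∧ ∫ t in a..c, signedPow r (b ^ t - x) = 0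

lemma hasDerivAt_integral_abs_sub_rpow {b r : ℝ} (hb : 1 < b) (hr : 1 < r) (a c x : ℝ) :
    HasDerivAt (fun z => ∫ t in a..c, |b ^ t - z| ^ r)
      (∫ t in a..c, -(r * signedPow r (b ^ t - x))) x := by
  have hcont : Continuous fun p : ℝ × ℝ => -(r * signedPow r (b ^ p.2 - p.1)) :=
    (((continuous_signedPow hr).comp (((Real.continuous_const_rpow (by linarith)).comp
      continuous_snd).sub continuous_fst)).const_mul r).neg
  obtain ⟨C, hC⟩ := (((isCompact_closedBall x 1).prod
    (isCompact_uIcc (a := a) (b := c))).image hcont).isBounded.exists_norm_le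
  refine (intervalIntegral.hasDerivAt_integral_of_dominated_loc_of_deriv_le
    (F := fun z t => |b ^ t - z| ^ r) (F' := fun z t => -(r * signedPow r (b ^ t - z)))
    (bound := fun _ => C)
    (Metric.closedBall_mem_nhds x one_pos) ?_ ?_ ?_ ?_ ?_ ?_).2
  · exact Filter.Eventually.of_forall fun z => (continuous_abs_sub_rpow hb hr z).aestronglyMeasurable
  · exact (continuous_abs_sub_rpow hb hr x).intervalIntegrable _ _
  · exact ((continuous_signedPow_sub hb hr x).const_mul r).neg.aestronglyMeasurable
  · exact Filter.Eventually.of_forall fun t ht z hz =>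
      hC _ ⟨(z, t), ⟨hz, uIoc_subset_uIcc ht⟩, rfl⟩
  · exact intervalIntegrable_const
  · refine Filter.Eventually.of_forall fun t _ z _ => ?_
    have := (hasDerivAt_abs_rpow_signedPow hr (b ^ t - z)).comp z
      ((hasDerivAt_id z).const_sub (b ^ t))
    simpa [Function.comp_def] using this

lemma isCenter_of_forall_le {b r a c x : ℝ} (hb : 1 < b) (hr : 1 < r) (hac : a < c)
    (h : ∀ z, ∫ t in a..c, |b ^ t - x| ^ r ≤ ∫ t in a..c, |b ^ t - z| ^ r) :
    IsCenter b r a c x := by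
  refine ⟨hac, ?_⟩
  have h0 := (IsLocalMin.hasDerivAt_eq_zero (Filter.Eventually.of_forall h)
    (hasDerivAt_integral_abs_sub_rpow hb hr a c x))
  rw [intervalIntegral.integral_neg, intervalIntegral.integral_const_mul, neg_eq_zero] at h0
  exact (mul_eq_zero.1 h0).resolve_left (by linarith)

lemma integral_signedPow_antitone {b r a c x x' : ℝ} (hb : 1 < b) (hr : 1 < r) (hac : a ≤ c)
    (hx : x ≤ x') :
    ∫ t in a..c, signedPow r (b ^ t - x') ≤ ∫ t in a..c, signedPow r (b ^ t - x) :=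
  intervalIntegral.integral_mono_on hac ((continuous_signedPow_sub hb hr _).intervalIntegrable _ _)
    ((continuous_signedPow_sub hb hr _).intervalIntegrable _ _)
    fun t _ => (signedPow_strictMono hr).monotone (by linarith)

lemma integral_signedPow_pos {b r a c x : ℝ} (hb : 1 < b) (hr : 1 < r) (hac : a < c)
    (hx : x ≤ b ^ a) : 0 < ∫ t in a..c, signedPow r (b ^ t - x) := by
  refine intervalIntegral.intervalIntegral_pos_of_pos_on
    ((continuous_signedPow_sub hb hr _).intervalIntegrable _ _) (fun t ht => ?_) hac
  rw [← signedPow_zero r]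
  have := Real.rpow_lt_rpow_of_exponent_lt hb ht.1
  exact signedPow_strictMono hr (by linarith)

lemma integral_signedPow_neg {b r a c x : ℝ} (hb : 1 < b) (hr : 1 < r) (hac : a < c)
    (hx : b ^ c ≤ x) : ∫ t in a..c, signedPow r (b ^ t - x) < 0 := by
  rw [← neg_pos, ← intervalIntegral.integral_neg]
  refine intervalIntegral.intervalIntegral_pos_of_pos_on
    ((continuous_signedPow_sub hb hr _).neg.intervalIntegrable _ _) (fun t ht => ?_) hac
  rw [neg_pos, ← signedPow_zero r]
  have := Real.rpow_lt_rpow_of_exponent_lt hb ht.2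
  exact signedPow_strictMono hr (by linarith)

lemma integral_signedPow_add {b r : ℝ} (hb : 1 < b) (hr : 1 < r) (a m c x : ℝ) :
    (∫ t in a..m, signedPow r (b ^ t - x)) + ∫ t in m..c, signedPow r (b ^ t - x) =
      ∫ t in a..c, signedPow r (b ^ t - x) :=
  intervalIntegral.integral_add_adjacent_intervals
    ((continuous_signedPow_sub hb hr _).intervalIntegrable _ _)
    ((continuous_signedPow_sub hb hr _).intervalIntegrable _ _)

namespace IsCenter

variable {b r a a' c c' x x' : ℝ}

lemma rpow_left_lt (h : IsCenter b r a c x) (hb : 1 < b) (hr : 1 < r) : b ^ a < x := by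
  by_contra! hx
  exact (integral_signedPow_pos hb hr h.1 hx).ne' h.2

lemma lt_rpow_right (h : IsCenter b r a c x) (hb : 1 < b) (hr : 1 < r) : x < b ^ c := by
  by_contra! hx
  exact (integral_signedPow_neg hb hr h.1 hx).ne h.2

lemma lt_of_right_lt (h : IsCenter b r a c x) (h' : IsCenter b r a c' x') (hb : 1 < b)
    (hr : 1 < r) (hc : c < c') : x < x' := by
  by_contra! hx
  have h1 := integral_signedPow_antitone hb hr h'.1.le hx
  have h2 := integral_signedPow_pos hb hr hc (h.lt_rpow_right hb hr).le
  have h3 := integral_signedPow_add hb hr a c c' x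
  linarith [h.2, h'.2]

lemma lt_of_left_lt (h : IsCenter b r a c x) (h' : IsCenter b r a' c x') (hb : 1 < b)
    (hr : 1 < r) (ha : a < a') : x < x' := by
  by_contra! hx
  have h1 := integral_signedPow_antitone hb hr h.1.le hx
  have h2 := integral_signedPow_neg hb hr ha (h'.rpow_left_lt hb hr).le
  have h3 := integral_signedPow_add hb hr a a' c x'
  linarith [h.2, h'.2]

lemma not_lt (h : IsCenter b r a c x) (h' : IsCenter b r a c x') (hb : 1 < b) (hr : 1 < r) :
    ¬ x < x' := by
  intro hx
  have hlt : 0 < ∫ t in a..c, (signedPow r (b ^ t - x) - signedPow r (b ^ t - x')) :=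
    intervalIntegral.intervalIntegral_pos_of_pos
      (((continuous_signedPow_sub hb hr _).sub
        (continuous_signedPow_sub hb hr _)).intervalIntegrable _ _)
      (fun t => sub_pos.2 (signedPow_strictMono hr (by linarith))) h.1
  rw [intervalIntegral.integral_sub ((continuous_signedPow_sub hb hr _).intervalIntegrable _ _)
    ((continuous_signedPow_sub hb hr _).intervalIntegrable _ _), h.2, h'.2] at hlt
  simp at hlt

lemma unique (h : IsCenter b r a c x) (h' : IsCenter b r a c x') (hb : 1 < b) (hr : 1 < r) :
    x = x' :=
  le_antisymm (_root_.not_lt.1 (h'.not_lt h hb hr)) (_root_.not_lt.1 (h.not_lt h' hb hr))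

lemma translate (h : IsCenter b r a c x) (hb : 1 < b) (s : ℝ) :
    IsCenter b r (a + s) (c + s) (b ^ s * x) := by
  have hb0 : 0 < b := by linarith
  refine ⟨by linarith [h.1], ?_⟩
  rw [← intervalIntegral.integral_comp_add_right (fun t => signedPow r (b ^ t - b ^ s * x))]
  have : ∀ t : ℝ, signedPow r (b ^ (t + s) - b ^ s * x) =
      (b ^ s) ^ (r - 1) * signedPow r (b ^ t - x) := fun t => by
    rw [← signedPow_mul (Real.rpow_pos_of_pos hb0 s), Real.rpow_add hb0]
    ring_nf
  simp_rw [this]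
  rw [intervalIntegral.integral_const_mul, h.2, mul_zero]

end IsCenter

/-- The `r`-th power cost of the step function that equals `Y j` on `[P j, P (j + 1)]`, `j < n`,
as an approximation of `t ↦ b ^ t`. -/
def stepCost (b r : ℝ) (n : ℕ) (Y P : ℕ → ℝ) : ℝ :=
  ∑ j ∈ Finset.range n, ∫ t in P j..P (j + 1), |b ^ t - Y j| ^ r

/-- Subdivisions of `[0, 1]` into `n` (possibly degenerate) intervals. -/
def IsSubdivision (n : ℕ) (P : ℕ → ℝ) : Prop := Monotone P ∧ P 0 = 0 ∧ P n = 1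

/-- Values and subdivision of a step function of minimal cost. -/
def IsOptimal (b r : ℝ) (n : ℕ) (Y P : ℕ → ℝ) : Prop :=
  IsSubdivision n P ∧
    ∀ Y' P', IsSubdivision n P' → stepCost b r n Y P ≤ stepCost b r n Y' P'

lemma IsSubdivision.update {n : ℕ} {P : ℕ → ℝ} (hP : IsSubdivision n P) {j : ℕ} (hj : j + 1 < n)
    {m : ℝ} (hm : m ∈ Icc (P j) (P (j + 2))) :
    IsSubdivision n (Function.update P (j + 1) m) := by
  refine ⟨monotone_nat_of_le_succ fun i => ?_, ?_, ?_⟩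
  · simp only [Function.update_apply]
    split_ifs with h1 h2 h2
    · omega
    · subst h1
      exact hm.2
    · obtain rfl : i = j := by omega
      exact hm.1
    · exact hP.1 (Nat.le_succ i)
  · simpa using hP.2.1
  · rw [Function.update_of_ne hj.ne', hP.2.2]

namespace IsOptimal

variable {b r : ℝ} {n : ℕ} {Y P Y' P' : ℕ → ℝ}

lemma integral_le (h : IsOptimal b r n Y P) {j : ℕ} (hj : j < n) (z : ℝ) :
    ∫ t in P j..P (j + 1), |b ^ t - Y j| ^ r ≤ ∫ t in P j..P (j + 1), |b ^ t - z| ^ r := by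
  have h1 := h.2 (Function.update Y j z) P h.1
  unfold stepCost at h1
  have hj' := Finset.mem_range.2 hj
  have hrest : ∑ i ∈ (Finset.range n).erase j,
      ∫ t in P i..P (i + 1), |b ^ t - Function.update Y j z i| ^ r =
      ∑ i ∈ (Finset.range n).erase j, ∫ t in P i..P (i + 1), |b ^ t - Y i| ^ r :=
    Finset.sum_congr rfl fun i hi => by rw [Function.update_of_ne (Finset.ne_of_mem_erase hi)]
  rw [← Finset.add_sum_erase _ _ hj', ← Finset.add_sum_erase _ _ hj', Function.update_self,
    hrest] at h1
  exact le_of_add_le_add_right h1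

/-- Exchanging the common endpoint and the values of two adjacent intervals. -/
lemma integral_add_integral_le (h : IsOptimal b r n Y P) {j : ℕ} (hj : j + 1 < n) {m : ℝ}
    (hm : m ∈ Icc (P j) (P (j + 2))) (z z' : ℝ) :
    (∫ t in P j..P (j + 1), |b ^ t - Y j| ^ r) +
        ∫ t in P (j + 1)..P (j + 2), |b ^ t - Y (j + 1)| ^ r ≤
      (∫ t in P j..m, |b ^ t - z| ^ r) + ∫ t in m..P (j + 2), |b ^ t - z'| ^ r := by
  have h1 := h.2 (Function.update (Function.update Y j z) (j + 1) z') _ (h.1.update hj hm)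
  unfold stepCost at h1
  have hj0 : j ∈ (Finset.range n).erase (j + 1) :=
    Finset.mem_erase.2 ⟨by omega, Finset.mem_range.2 (by omega)⟩
  have hj1 := Finset.mem_range.2 hj
  have hrest : ∑ i ∈ ((Finset.range n).erase (j + 1)).erase j,
      ∫ t in Function.update P (j + 1) m i..Function.update P (j + 1) m (i + 1),
        |b ^ t - Function.update (Function.update Y j z) (j + 1) z' i| ^ r =
      ∑ i ∈ ((Finset.range n).erase (j + 1)).erase j,
        ∫ t in P i..P (i + 1), |b ^ t - Y i| ^ r :=
    Finset.sum_congr rfl fun i hi => by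
      have h1 : i ≠ j := Finset.ne_of_mem_erase hi
      have h2 : i ≠ j + 1 := Finset.ne_of_mem_erase (Finset.mem_of_mem_erase hi)
      rw [Function.update_of_ne h2, Function.update_of_ne h1, Function.update_of_ne h2,
        Function.update_of_ne (by omega)]
  rw [← Finset.add_sum_erase _ _ hj1, ← Finset.add_sum_erase _ _ hj1,
    ← Finset.add_sum_erase _ _ hj0, ← Finset.add_sum_erase _ _ hj0, hrest] at h1
  have e1 : Function.update P (j + 1) m j = P j := Function.update_of_ne (by omega) _ _
  have e2 : Function.update P (j + 1) m (j + 1 + 1) = P (j + 2) :=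
    Function.update_of_ne (by omega) _ _
  have e3 : Function.update (Function.update Y j z) (j + 1) z' j = z := by
    rw [Function.update_of_ne (by omega), Function.update_self]
  rw [Function.update_self, Function.update_self, e1, e2, e3] at h1
  linarith

lemma isCenter (h : IsOptimal b r n Y P) (hb : 1 < b) (hr : 1 < r) {j : ℕ} (hj : j < n)
    (hP : P j < P (j + 1)) : IsCenter b r (P j) (P (j + 1)) (Y j) :=
  isCenter_of_forall_le hb hr hP (h.integral_le hj)

end IsOptimal

/-- On a nondegenerate interval two values are strictly better than one. -/
lemma eq_of_forall_integral_le_split {b r a c z : ℝ} (hb : 1 < b) (hr : 1 < r) (hac : a ≤ c)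
    (h : ∀ m ∈ Icc a c, ∀ x x', ∫ t in a..c, |b ^ t - z| ^ r ≤
      (∫ t in a..m, |b ^ t - x| ^ r) + ∫ t in m..c, |b ^ t - x'| ^ r) : a = c := by
  by_contra hne
  have hlt : a < c := lt_of_le_of_ne hac hne
  have key : ∀ m ∈ Ioc a c, IsCenter b r a m z := fun m hm =>
    isCenter_of_forall_le hb hr hm.1 fun x => by
      have h1 := h m ⟨hm.1.le, hm.2⟩ x z
      rw [← intervalIntegral.integral_add_adjacent_intervals
        ((continuous_abs_sub_rpow hb hr z).intervalIntegrable a m)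
        ((continuous_abs_sub_rpow hb hr z).intervalIntegrable m c)] at h1
      exact le_of_add_le_add_right h1
  exact lt_irrefl z ((key ((a + c) / 2) ⟨by linarith, by linarith⟩).lt_of_right_lt
    (key c ⟨hlt, le_rfl⟩) hb hr (by linarith))

namespace IsOptimal

variable {b r : ℝ} {n : ℕ} {Y P Y' P' : ℕ → ℝ}

lemma eq_succ_iff (h : IsOptimal b r n Y P) (hb : 1 < b) (hr : 1 < r) {j : ℕ} (hj : j + 1 < n) :
    P j = P (j + 1) ↔ P (j + 1) = P (j + 2) := by
  have hle : P j ≤ P (j + 2) := h.1.1 (by omega)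
  constructor <;> intro he
  · have h2 : P j = P (j + 2) :=
      eq_of_forall_integral_le_split hb hr hle (z := Y (j + 1)) fun m hm x x' => by
        have := h.integral_add_integral_le hj hm x x'
        rwa [← he, intervalIntegral.integral_same, zero_add] at this
    rw [← he, h2]
  · have h2 : P j = P (j + 2) :=
      eq_of_forall_integral_le_split hb hr hle (z := Y j) fun m hm x x' => by
        have := h.integral_add_integral_le hj hm x x'
        rwa [he, intervalIntegral.integral_same, add_zero] at this
    rw [he, h2]

lemma lt_succ (h : IsOptimal b r n Y P) (hb : 1 < b) (hr : 1 < r) {j : ℕ} (hj : j < n) :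
    P j < P (j + 1) := by
  have hiff : ∀ i, i < n → (P i = P (i + 1) ↔ P 0 = P 1) := by
    intro i
    induction i with
    | zero => intro _; rfl
    | succ i ih => exact fun hi => (h.eq_succ_iff hb hr hi).symm.trans (ih (by omega))
  refine lt_of_le_of_ne (h.1.1 (Nat.le_succ j)) fun he => ?_
  have h0 := (hiff j hj).1 he
  have hconst : ∀ i, i ≤ n → P i = 0 := by
    intro i
    induction i with
    | zero => exact fun _ => h.1.2.1
    | succ i ih => exact fun hi => ((hiff i hi).2 h0) ▸ ih (by omega)
  have := hconst n le_rfl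
  rw [h.1.2.2] at this
  exact one_ne_zero this

lemma rpow_eq_midpoint (h : IsOptimal b r n Y P) (hb : 1 < b) (hr : 1 < r) {j : ℕ}
    (hj : j + 1 < n) : 2 * b ^ P (j + 1) = Y j + Y (j + 1) := by
  have l0 := h.lt_succ hb hr (j := j) (by omega)
  have l1 := h.lt_succ hb hr hj
  have hmin : IsLocalMin (fun m => (∫ t in P j..m, |b ^ t - Y j| ^ r) +
      ∫ t in m..P (j + 2), |b ^ t - Y (j + 1)| ^ r) (P (j + 1)) := by
    filter_upwards [Icc_mem_nhds l0 l1] with m hm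
    exact h.integral_add_integral_le hj hm _ _
  have c0 := continuous_abs_sub_rpow hb hr (Y j)
  have c1 := continuous_abs_sub_rpow hb hr (Y (j + 1))
  have hd := (intervalIntegral.integral_hasDerivAt_right
    (c0.intervalIntegrable (P j) (P (j + 1))) (c0.stronglyMeasurableAtFilter _ _) c0.continuousAt).add
    (intervalIntegral.integral_hasDerivAt_left
    (c1.intervalIntegrable (P (j + 1)) (P (j + 2))) (c1.stronglyMeasurableAtFilter _ _) c1.continuousAt)
  have h0 := hmin.hasDerivAt_eq_zero hd
  have heq : |b ^ P (j + 1) - Y j| ^ r = |b ^ P (j + 1) - Y (j + 1)| ^ r := by linarith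
  rw [Real.rpow_left_inj (abs_nonneg _) (abs_nonneg _) (by linarith)] at heq
  have u0 := (h.isCenter hb hr (j := j) (by omega) l0).lt_rpow_right hb hr
  have u1 := (h.isCenter hb hr hj l1).rpow_left_lt hb hr
  rw [abs_of_pos (by linarith), abs_of_neg (by linarith)] at heq
  linarith

/-- The interval lengths of optimal subdivisions are ordered like the first ones: by the midpoint
condition and homogeneity, each length is a nondecreasing function of the preceding one. -/
lemma length_le (h : IsOptimal b r n Y P) (h' : IsOptimal b r n Y' P') (hb : 1 < b) (hr : 1 < r)
    (h1 : P 1 - P 0 ≤ P' 1 - P' 0) :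
    ∀ j, j < n → P (j + 1) - P j ≤ P' (j + 1) - P' j := by
  have hb0 : 0 < b := by linarith
  intro j
  induction j with
  | zero => exact fun _ => h1
  | succ j ih =>
    intro hj
    have ih := ih (by omega)
    by_contra! hlt
    have z0 := (h.isCenter hb hr (by omega) (h.lt_succ hb hr (j := j) (by omega))).translate hb (-P (j + 1))
    have z0' :=
      (h'.isCenter hb hr (by omega) (h'.lt_succ hb hr (j := j) (by omega))).translate hb (-P' (j + 1))
    have z1 := (h.isCenter hb hr hj (h.lt_succ hb hr hj)).translate hb (-P (j + 1))
    have z1' := (h'.isCenter hb hr hj (h'.lt_succ hb hr hj)).translate hb (-P' (j + 1))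
    rw [add_neg_cancel] at z0 z0' z1 z1'
    have hx := z1'.lt_of_right_lt z1 hb hr (by linarith)
    have hmid : ∀ {Y P : ℕ → ℝ}, IsOptimal b r n Y P →
        b ^ (-P (j + 1)) * Y j + b ^ (-P (j + 1)) * Y (j + 1) = 2 := fun {Y P} h => by
      rw [← mul_add, ← h.rpow_eq_midpoint hb hr hj, mul_left_comm, ← Real.rpow_add hb0]
      simp
    have hy : b ^ (-P' (j + 1)) * Y' j ≤ b ^ (-P (j + 1)) * Y j := by
      rcases ih.lt_or_eq with hl | he
      · exact (z0'.lt_of_left_lt z0 hb hr (by linarith)).le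
      · rw [show P j + -P (j + 1) = P' j + -P' (j + 1) by linarith] at z0
        exact (z0'.unique z0 hb hr).le
    linarith [hmid h, hmid h']

lemma subdivision_eq_of_length_le (h : IsOptimal b r n Y P) (h' : IsOptimal b r n Y' P')
    (hl : ∀ j, j < n → P (j + 1) - P j ≤ P' (j + 1) - P' j) : ∀ j, j ≤ n → P j = P' j := by
  have hsum : ∑ j ∈ Finset.range n, (P (j + 1) - P j) =
      ∑ j ∈ Finset.range n, (P' (j + 1) - P' j) := by
    rw [Finset.sum_range_sub, Finset.sum_range_sub, h.1.2.1, h.1.2.2, h'.1.2.1, h'.1.2.2]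
  have heq := (Finset.sum_eq_sum_iff_of_le fun j hj => hl j (Finset.mem_range.1 hj)).1 hsum
  intro j
  induction j with
  | zero => exact fun _ => by rw [h.1.2.1, h'.1.2.1]
  | succ j ih =>
    intro hj
    have := heq j (Finset.mem_range.2 hj)
    linarith [ih (by omega)]

lemma subdivision_unique (h : IsOptimal b r n Y P) (h' : IsOptimal b r n Y' P') (hb : 1 < b)
    (hr : 1 < r) : ∀ j, j ≤ n → P j = P' j := by
  rcases le_total (P 1 - P 0) (P' 1 - P' 0) with h1 | h1
  · exact h.subdivision_eq_of_length_le h' (h.length_le h' hb hr h1)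
  · exact fun j hj => (h'.subdivision_eq_of_length_le h (h'.length_le h hb hr h1) j hj).symm

lemma values_unique (h : IsOptimal b r n Y P) (h' : IsOptimal b r n Y' P') (hb : 1 < b)
    (hr : 1 < r) {j : ℕ} (hj : j < n) : Y j = Y' j := by
  have hc := h.isCenter hb hr hj (h.lt_succ hb hr hj)
  rw [h.subdivision_unique h' hb hr j hj.le, h.subdivision_unique h' hb hr (j + 1) hj] at hc
  exact hc.unique (h'.isCenter hb hr hj (h'.lt_succ hb hr hj)) hb hr

lemma values_lt (h : IsOptimal b r n Y P) (hb : 1 < b) (hr : 1 < r) {i j : ℕ} (hij : i < j)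
    (hj : j < n) : Y i < Y j := by
  have h1 := (h.isCenter hb hr (hij.trans hj) (h.lt_succ hb hr (hij.trans hj))).lt_rpow_right hb hr
  have h2 := (h.isCenter hb hr hj (h.lt_succ hb hr hj)).rpow_left_lt hb hr
  exact h1.trans (lt_of_le_of_lt (Real.rpow_le_rpow_of_exponent_le hb.le (h.1.1 hij)) h2)

end IsOptimal

lemma psum_zero (n : ℕ) (q : Fin n → ℝ) : psum n q 0 = 0 := by simp [psum]

lemma psum_succ {n : ℕ} (q : Fin n → ℝ) {j : ℕ} (hj : j < n) :
    psum n q (j + 1) = psum n q j + q ⟨j, hj⟩ := by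
  have h : q ⟨j, hj⟩ = ∑ i : Fin n, if i = ⟨j, hj⟩ then q i else 0 := by simp
  rw [psum, psum, h, ← Finset.sum_add_distrib]
  refine Finset.sum_congr rfl fun i _ => ?_
  rcases lt_trichotomy (i : ℕ) j with hi | hi | hi
  · simp [hi, Fin.ext_iff, hi.ne, Nat.lt_succ_of_lt hi]
  · simp [Fin.ext_iff, hi]
  · simp [Fin.ext_iff, hi.ne', hi.not_gt, show ¬ (i : ℕ) < j + 1 by omega]

lemma isSubdivision_psum {n : ℕ} {q : Fin n → ℝ} (hq : IsPi n q) : IsSubdivision n (psum n q) := by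
  refine ⟨fun i k hik => Finset.sum_le_sum fun j _ => ?_, psum_zero n q, ?_⟩
  · split_ifs with h1 h2
    · exact le_rfl
    · omega
    · exact hq.1 j
    · exact le_rfl
  · rw [← hq.2]
    exact Finset.sum_congr rfl fun j _ => if_pos j.2

lemma psum_sub {n : ℕ} {P : ℕ → ℝ} (hP : P 0 = 0) {j : ℕ} (hj : j ≤ n) :
    psum n (fun i => P (i + 1) - P i) j = P j := by
  induction j with
  | zero => rw [psum_zero, hP]
  | succ j ih => rw [psum_succ _ hj, ih (by omega)]; ring

lemma xcoord_of_lt {n : ℕ} (x : Fin n → ℝ) {j : ℕ} (hj : j < n) : xcoord n x j = x ⟨j, hj⟩ :=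
  dif_pos hj

lemma discr_apply_toReal {n : ℕ} {x p : Fin n → ℝ} (hp : ∀ j, 0 ≤ p j) {S : Set ℝ}
    [DecidablePred (· ∈ S)] (hS : MeasurableSet S) :
    (discr n x p S).toReal = ∑ j, if x j ∈ S then p j else 0 := by
  rw [discr, Measure.finsetSum_apply, ENNReal.toReal_sum]
  · refine Finset.sum_congr rfl fun j _ => ?_
    rw [Measure.smul_apply, Measure.dirac_apply' _ hS]
    by_cases h : x j ∈ S <;> simp [h, hp j]
  · intro j _
    rw [Measure.smul_apply, Measure.dirac_apply' _ hS]
    by_cases h : x j ∈ S <;> simp [h]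

lemma discr_apply_le_psum {n : ℕ} {x p : Fin n → ℝ} (hp : ∀ j, 0 ≤ p j) {S : Set ℝ}
    (hS : MeasurableSet S) {j : ℕ} (h : ∀ i, x i ∈ S → (i : ℕ) < j) :
    (discr n x p S).toReal ≤ psum n p j := by
  classical
  rw [discr_apply_toReal hp hS]
  refine Finset.sum_le_sum fun i _ => ?_
  split_ifs with h1 h2 h2
  · exact le_rfl
  · exact absurd (h i h1) h2
  · exact hp i
  · exact le_rfl

lemma psum_le_discr_apply {n : ℕ} {x p : Fin n → ℝ} (hp : ∀ j, 0 ≤ p j) {S : Set ℝ}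
    (hS : MeasurableSet S) {j : ℕ} (h : ∀ i : Fin n, (i : ℕ) < j → x i ∈ S) :
    psum n p j ≤ (discr n x p S).toReal := by
  classical
  rw [discr_apply_toReal hp hS]
  refine Finset.sum_le_sum fun i _ => ?_
  split_ifs with h1 h2 h2
  · exact le_rfl
  · exact absurd (h i h1) h2
  · exact hp i
  · exact le_rfl

lemma quant_discr {A B : ℝ} {n : ℕ} {x p : Fin n → ℝ} (hx : IsXi A B n x)
    (hp : IsPi n p) {j : ℕ} (hj : j < n) {t : ℝ} (ht : t ∈ Ico (psum n p j) (psum n p (j + 1))) :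
    quant (discr n x p) A B t = x ⟨j, hj⟩ := by
  have hpos : 0 ≤ t :=
    (psum_zero n p ▸ (isSubdivision_psum hp).1 (Nat.zero_le j) : 0 ≤ psum n p j).trans ht.1
  have hle : ∀ i : Fin n, (i : ℕ) < j + 1 → x i ≤ x ⟨j, hj⟩ := fun i hi =>
    hx.2 (Fin.mk_le_mk.2 (Nat.lt_succ_iff.1 hi))
  have hlt : ∀ i : Fin n, x i < x ⟨j, hj⟩ → (i : ℕ) < j := fun i hi => by
    by_contra! h
    exact absurd (hx.2 (show (⟨j, hj⟩ : Fin n) ≤ i from h)) (not_le.2 hi)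
  rcases (hx.1 ⟨j, hj⟩).1.eq_or_lt with hA | hA
  · rw [quant, if_pos (Or.inl (lt_of_lt_of_le ht.2 ?_)), hA]
    exact psum_le_discr_apply hp.1 (measurableSet_singleton A) fun i hi =>
      le_antisymm (hA ▸ hle i hi) (hx.1 i).1
  · have h1 : ¬ (t < (discr n x p {A}).toReal ∨ t < 0) := by
      push Not
      refine ⟨(discr_apply_le_psum hp.1 (measurableSet_singleton A) fun i hi => ?_).trans ht.1,
        hpos⟩
      exact hlt i (by rw [show x i = A from hi]; exact hA)
    have hset : {y ∈ Icc A B | cdf (discr n x p) A B y ≤ t} = Ico A (x ⟨j, hj⟩) := by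
      ext y
      constructor
      · rintro ⟨hy, hcdf⟩
        refine ⟨hy.1, ?_⟩
        by_contra! hxy
        refine absurd (lt_of_lt_of_le ht.2 ?_) (not_lt.2 hcdf)
        exact psum_le_discr_apply hp.1 (measurableSet_Icc.inter measurableSet_Iic) fun i hi =>
          ⟨hx.1 i, (hle i hi).trans hxy⟩
      · rintro ⟨hy1, hy2⟩
        refine ⟨⟨hy1, hy2.le.trans (hx.1 _).2⟩, le_trans ?_ ht.1⟩
        exact discr_apply_le_psum hp.1 (measurableSet_Icc.inter measurableSet_Iic) fun i hi =>
          hlt i (lt_of_le_of_lt hi.2 hy2)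
    rw [quant, if_neg h1, hset, csSup_Ico hA]

lemma cdf_benford {b : ℝ} (hb : 1 < b) {y : ℝ} (hy : y ∈ Ico 1 b) :
    cdf (benford b) 1 b y = Real.logb b y := by
  have hmeas : Measurable fun t : ℝ => b ^ t :=
    (Real.continuous_const_rpow (by linarith)).measurable
  have hy0 : 0 < y := by linarith [hy.1]
  have hset : (fun t : ℝ => b ^ t) ⁻¹' (Icc 1 b ∩ Iic y) ∩ Ico 0 1 = Icc 0 (Real.logb b y) := by
    ext t
    have hl : Real.logb b y < 1 := by
      rw [← Real.logb_self_eq_one hb]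
      exact Real.logb_lt_logb hb hy0 hy.2
    simp only [mem_inter_iff, mem_preimage, mem_Icc, mem_Iic, mem_Ico,
      Real.le_logb_iff_rpow_le hb hy0]
    constructor
    · rintro ⟨⟨-, h⟩, h0, -⟩
      exact ⟨h0, h⟩
    · rintro ⟨h0, h⟩
      exact ⟨⟨⟨Real.one_le_rpow hb.le h0, h.trans hy.2.le⟩, h⟩, h0,
        ((Real.le_logb_iff_rpow_le hb hy0).2 h).trans_lt hl⟩
  rw [cdf, benford, Measure.map_apply hmeas (measurableSet_Icc.inter measurableSet_Iic),
    Measure.restrict_apply (hmeas (measurableSet_Icc.inter measurableSet_Iic)), hset,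
    Real.volume_Icc, sub_zero, ENNReal.toReal_ofReal (Real.logb_nonneg hb hy.1)]

lemma quant_benford {b : ℝ} (hb : 1 < b) {t : ℝ} (ht : t ∈ Ioo (0 : ℝ) 1) :
    quant (benford b) 1 b t = b ^ t := by
  have hb0 : 0 < b := by linarith
  have hmono : ∀ {s u : ℝ}, s < u → b ^ s < b ^ u := Real.rpow_lt_rpow_of_exponent_lt hb
  have h1t : 1 < b ^ t := Real.one_lt_rpow hb ht.1
  have htb : b ^ t < b := by simpa using hmono ht.2
  have hone : (benford b {1}).toReal ≤ 0 := by
    have h := cdf_benford hb (y := 1) ⟨le_rfl, hb⟩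
    have : Icc 1 b ∩ Iic (1 : ℝ) = {1} := by
      ext y
      simp only [mem_inter_iff, mem_Icc, mem_Iic, mem_singleton_iff]
      exact ⟨fun h => le_antisymm h.2 h.1.1, fun h => by subst h; exact ⟨⟨le_rfl, hb.le⟩, le_rfl⟩⟩
    rw [cdf, this, Real.logb_one] at h
    exact h.le
  have hone_le : 1 ≤ cdf (benford b) 1 b b := by
    have hmeas : Measurable fun t : ℝ => b ^ t := (Real.continuous_const_rpow hb0.ne').measurable
    have hset : Ico (0 : ℝ) 1 ⊆ (fun t : ℝ => b ^ t) ⁻¹' (Icc 1 b ∩ Iic b) := fun s hs => by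
      have : b ^ s < b := by simpa using hmono hs.2
      exact ⟨⟨Real.one_le_rpow hb.le hs.1, this.le⟩, this.le⟩
    rw [cdf, benford, Measure.map_apply hmeas (measurableSet_Icc.inter measurableSet_Iic),
      Measure.restrict_apply (hmeas (measurableSet_Icc.inter measurableSet_Iic)),
      inter_eq_self_of_subset_right hset]
    simp
  have hset : {y ∈ Icc 1 b | cdf (benford b) 1 b y ≤ t} = Icc 1 (b ^ t) := by
    ext y
    constructor
    · rintro ⟨hy, hcdf⟩
      rcases hy.2.eq_or_lt with rfl | hyb
      · linarith [ht.2]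
      · rw [cdf_benford hb ⟨hy.1, hyb⟩, Real.logb_le_iff_le_rpow hb (by linarith [hy.1])] at hcdf
        exact ⟨hy.1, hcdf⟩
    · rintro ⟨hy1, hy2⟩
      refine ⟨⟨hy1, hy2.trans htb.le⟩, ?_⟩
      rw [cdf_benford hb ⟨hy1, hy2.trans_lt htb⟩, Real.logb_le_iff_le_rpow hb (by linarith)]
      exact hy2
  have hcond : ¬ (t < (benford b {1}).toReal ∨ t < 0) := by
    push Not
    exact ⟨hone.trans ht.1.le, ht.1.le⟩
  rw [quant, if_neg hcond, hset, csSup_Icc h1t.le]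

lemma integral_quant_benford_discr {b r : ℝ} (hb : 1 < b) (hr : 1 < r) {n : ℕ}
    {x p : Fin n → ℝ} (hx : IsXi 1 b n x) (hp : IsPi n p) :
    ∫ t in Ioo (0 : ℝ) 1, |quant (benford b) 1 b t - quant (discr n x p) 1 b t| ^ r =
      stepCost b r n (xcoord n x) (psum n p) := by
  obtain ⟨hmono, h0, h1⟩ := isSubdivision_psum hp
  have heq : ∀ j < n, EqOn (fun t : ℝ => |b ^ t - xcoord n x j| ^ r)
      (fun t => |quant (benford b) 1 b t - quant (discr n x p) 1 b t| ^ r)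
      (Ioo (psum n p j) (psum n p (j + 1))) := fun j hj t ht => by
    have ht01 : t ∈ Ioo (0 : ℝ) 1 :=
      ⟨(h0 ▸ hmono (Nat.zero_le j) : 0 ≤ psum n p j).trans_lt ht.1,
        ht.2.trans_le (h1 ▸ hmono hj : psum n p (j + 1) ≤ 1)⟩
    simp only [quant_benford hb ht01, quant_discr hx hp hj (Ioo_subset_Ico_self ht),
      xcoord_of_lt x hj]
  have hsum := intervalIntegral.sum_integral_adjacent_intervals (a := psum n p) (n := n)
    (f := fun t => |quant (benford b) 1 b t - quant (discr n x p) 1 b t| ^ r) (μ := volume)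
    fun j hj => by
      refine ((continuous_abs_sub_rpow hb hr (xcoord n x j)).intervalIntegrable _ _).congr_uIoo ?_
      rw [uIoo_of_le (hmono (Nat.le_succ j))]
      exact heq j hj
  rw [h0, h1] at hsum
  rw [← integral_Ioc_eq_integral_Ioo, ← intervalIntegral.integral_of_le zero_le_one, ← hsum,
    stepCost]
  exact Finset.sum_congr rfl fun j hj => (intervalIntegral.integral_congr_Ioo_of_le
    (hmono (Nat.le_succ j)) (heq j (Finset.mem_range.1 hj))).symm

lemma dKant_benford_discr_le_iff {b r : ℝ} (hb : 1 < b) (hr : 1 < r) {n : ℕ}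
    {x p y q : Fin n → ℝ} (hx : IsXi 1 b n x) (hp : IsPi n p) (hy : IsXi 1 b n y)
    (hq : IsPi n q) :
    dKant 1 b r (benford b) (discr n x p) ≤ dKant 1 b r (benford b) (discr n y q) ↔
      stepCost b r n (xcoord n x) (psum n p) ≤ stepCost b r n (xcoord n y) (psum n q) := by
  rw [← integral_quant_benford_discr hb hr hx hp, ← integral_quant_benford_discr hb hr hy hq,
    dKant, dKant, mul_le_mul_iff_right₀ (inv_pos.2 (by linarith)),
    Real.rpow_le_rpow_iff _ _ (by positivity)]
  · exact integral_nonneg fun _ => Real.rpow_nonneg (abs_nonneg _) _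
  · exact integral_nonneg fun _ => Real.rpow_nonneg (abs_nonneg _) _

/-- Clamping the values of a step function to the range of `t ↦ b ^ t` on the respective interval
does not increase its cost. -/
lemma exists_stepCost_le {b r : ℝ} (hb : 1 < b) (hr : 1 < r) {n : ℕ} (Y : ℕ → ℝ) {P : ℕ → ℝ}
    (hP : IsSubdivision n P) :
    ∃ y q : Fin n → ℝ, IsXi 1 b n y ∧ IsPi n q ∧
      stepCost b r n (xcoord n y) (psum n q) ≤ stepCost b r n Y P := by
  have hexp : Monotone fun t : ℝ => b ^ t := fun s t hst =>
    Real.rpow_le_rpow_of_exponent_le hb.le hst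
  have hmem : ∀ j, max (b ^ P j) (min (Y j) (b ^ P (j + 1))) ∈ Icc (b ^ P j) (b ^ P (j + 1)) :=
    fun j => ⟨le_max_left _ _, max_le (hexp (hP.1 (Nat.le_succ j))) (min_le_right _ _)⟩
  refine ⟨fun j => max (b ^ P j) (min (Y j) (b ^ P (j + 1))), fun j => P (j + 1) - P j,
    ⟨fun j => ⟨?_, ?_⟩, fun i j hij => ?_⟩, ⟨fun j => ?_, ?_⟩, ?_⟩
  · refine le_trans ?_ (hmem j).1
    have := hexp (hP.1 (Nat.zero_le j))
    simpa [hP.2.1] using this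
  · refine (hmem j).2.trans ?_
    have := hexp (hP.1 j.2)
    simpa [hP.2.2] using this
  · rcases hij.eq_or_lt with rfl | hlt
    · exact le_rfl
    · exact (hmem i).2.trans ((hexp (hP.1 hlt)).trans (hmem j).1)
  · exact sub_nonneg.2 (hP.1 (Nat.le_succ _))
  · rw [Fin.sum_univ_eq_sum_range (fun j => P (j + 1) - P j), Finset.sum_range_sub, hP.2.1, hP.2.2,
      sub_zero]
  · refine Finset.sum_le_sum fun j hj => ?_
    have hj := Finset.mem_range.1 hj
    rw [psum_sub hP.2.1 hj.le, psum_sub hP.2.1 (Nat.succ_le_of_lt hj), xcoord_of_lt _ hj]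
    refine intervalIntegral.integral_mono_on (hP.1 (Nat.le_succ j))
      ((continuous_abs_sub_rpow hb hr _).intervalIntegrable _ _)
      ((continuous_abs_sub_rpow hb hr _).intervalIntegrable _ _) fun t ht => ?_
    refine Real.rpow_le_rpow (abs_nonneg _) ?_ (by linarith)
    have h1 := hexp ht.1
    have h2 := hexp ht.2
    simp only at h1 h2 ⊢
    rcases le_total (Y j) (b ^ P (j + 1)) with h3 | h3
    · rw [min_eq_left h3]
      rcases le_total (Y j) (b ^ P j) with h4 | h4
      · rw [max_eq_left h4, abs_of_nonneg (by linarith), abs_of_nonneg (by linarith)]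
        linarith
      · rw [max_eq_right h4]
    · rw [min_eq_right h3, max_eq_right (h1.trans h2), abs_of_nonpos (by linarith),
        abs_of_nonpos (by linarith)]
      linarith

lemma isOptimal_of_forall_dKant_le {b r : ℝ} (hb : 1 < b) (hr : 1 < r) {n : ℕ}
    {x p : Fin n → ℝ} (hx : IsXi 1 b n x) (hp : IsPi n p)
    (h : ∀ y q : Fin n → ℝ, IsXi 1 b n y → IsPi n q →
      dKant 1 b r (benford b) (discr n x p) ≤ dKant 1 b r (benford b) (discr n y q)) :
    IsOptimal b r n (xcoord n x) (psum n p) := by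
  refine ⟨isSubdivision_psum hp, fun Y P hP => ?_⟩
  obtain ⟨y, q, hy, hq, hle⟩ := exists_stepCost_le hb hr Y hP
  exact ((dKant_benford_discr_le_iff hb hr hx hp hy hq).1 (h y q hy hq)).trans hle

lemma continuous_psum (n j : ℕ) : Continuous fun q : Fin n → ℝ => psum n q j := by
  unfold psum
  refine continuous_finsetSum _ fun i _ => ?_
  split_ifs
  · exact continuous_apply i
  · exact continuous_const

lemma continuous_xcoord (n j : ℕ) : Continuous fun x : Fin n → ℝ => xcoord n x j := by
  unfold xcoord
  split_ifs with h
  · exact continuous_apply _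
  · exact continuous_const

lemma continuous_stepCost {b r : ℝ} (hb : 1 < b) (hr : 1 < r) (n : ℕ) :
    Continuous fun z : (Fin n → ℝ) × (Fin n → ℝ) =>
      stepCost b r n (xcoord n z.1) (psum n z.2) := by
  unfold stepCost
  refine continuous_finsetSum _ fun j _ => ?_
  have hf : Continuous (Function.uncurry fun (z : (Fin n → ℝ) × (Fin n → ℝ)) (t : ℝ) =>
      |b ^ t - xcoord n z.1 j| ^ r) :=
    (((Real.continuous_const_rpow (by linarith)).comp continuous_snd).sub
      ((continuous_xcoord n j).comp (continuous_fst.comp continuous_fst))).abs.rpow_const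
      fun _ => Or.inr (by linarith)
  have hinteg : ∀ (z : (Fin n → ℝ) × (Fin n → ℝ)) (c : ℝ),
      IntervalIntegrable (fun t : ℝ => |b ^ t - xcoord n z.1 j| ^ r) volume 0 c := fun z c =>
    (continuous_abs_sub_rpow hb hr _).intervalIntegrable _ _
  simp_rw [← fun z : (Fin n → ℝ) × (Fin n → ℝ) => intervalIntegral.integral_interval_sub_left
    (hinteg z (psum n z.2 (j + 1))) (hinteg z (psum n z.2 j))]
  exact (intervalIntegral.continuous_parametric_intervalIntegral_of_continuous hf
    ((continuous_psum n _).comp continuous_snd)).sub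
    (intervalIntegral.continuous_parametric_intervalIntegral_of_continuous hf
    ((continuous_psum n _).comp continuous_snd))

lemma isCompact_setOf_isXi_isPi (A B : ℝ) (n : ℕ) :
    IsCompact {z : (Fin n → ℝ) × (Fin n → ℝ) | IsXi A B n z.1 ∧ IsPi n z.2} := by
  refine IsCompact.of_isClosed_subset
    ((isCompact_Icc (a := fun _ : Fin n => A) (b := fun _ => B)).prod
      (isCompact_Icc (a := fun _ : Fin n => (0 : ℝ)) (b := fun _ => 1))) ?_ ?_
  · simp only [IsXi, IsPi, Monotone, mem_Icc, ofPred_and, ofPred_forall]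
    refine IsClosed.inter (IsClosed.inter ?_ ?_) (IsClosed.inter ?_ ?_)
    · exact isClosed_iInter fun j => (isClosed_le (by fun_prop) (by fun_prop)).inter
        (isClosed_le (by fun_prop) (by fun_prop))
    · exact isClosed_iInter fun i => isClosed_iInter fun j => isClosed_iInter fun _ =>
        isClosed_le (by fun_prop) (by fun_prop)
    · exact isClosed_iInter fun j => isClosed_le (by fun_prop) (by fun_prop)
    · exact isClosed_eq (by fun_prop) (by fun_prop)
  · rintro ⟨x, p⟩ ⟨hx, hp⟩
    refine ⟨⟨fun j => (hx.1 j).1, fun j => (hx.1 j).2⟩, ⟨hp.1, fun j => ?_⟩⟩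
    have := Finset.single_le_sum (fun i _ => hp.1 i) (Finset.mem_univ j)
    rwa [hp.2] at this

lemma exists_forall_dKant_benford_le {b r : ℝ} (hb : 1 < b) (hr : 1 < r) {n : ℕ} (hn : 0 < n) :
    ∃ x p : Fin n → ℝ, IsXi 1 b n x ∧ IsPi n p ∧
      ∀ y q : Fin n → ℝ, IsXi 1 b n y → IsPi n q →
        dKant 1 b r (benford b) (discr n x p) ≤ dKant 1 b r (benford b) (discr n y q) := by
  have hp0 : IsPi n (Pi.single ⟨0, hn⟩ 1) := by
    refine ⟨fun j => ?_, by simp⟩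
    rw [Pi.single_apply]
    split_ifs <;> norm_num
  have hx0 : IsXi 1 b n fun _ => 1 := ⟨fun _ => ⟨le_rfl, hb.le⟩, monotone_const⟩
  obtain ⟨z, hz, hmin⟩ := (isCompact_setOf_isXi_isPi 1 b n).exists_isMinOn ⟨(_, _), hx0, hp0⟩
    (continuous_stepCost hb hr n).continuousOn
  refine ⟨z.1, z.2, hz.1, hz.2, fun y q hy hq => ?_⟩
  rw [dKant_benford_discr_le_iff hb hr hz.1 hz.2 hy hq]
  exact isMinOn_iff.1 hmin (y, q) ⟨hy, hq⟩

/-- Thm. 4.6: existence and uniqueness of the best `d_r`-approximation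
of the Benford measure `β_b` with at most `n` atoms; its support has exactly `n` points. -/
theorem best_dKant_benford_exists_unique (b r : ℝ) (hb : 1 < b) (hr : 1 < r)
    (n : ℕ) (hn : 0 < n) :
    ∃ x p : Fin n → ℝ, IsXi 1 b n x ∧ IsPi n p ∧
      (∀ y q : Fin n → ℝ, IsXi 1 b n y → IsPi n q →
        dKant 1 b r (benford b) (discr n x p) ≤ dKant 1 b r (benford b) (discr n y q)) ∧
      (Set.range x).ncard = n ∧
      (∀ y q : Fin n → ℝ, IsXi 1 b n y → IsPi n q →
        (∀ y' q' : Fin n → ℝ, IsXi 1 b n y' → IsPi n q' →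
          dKant 1 b r (benford b) (discr n y q) ≤ dKant 1 b r (benford b) (discr n y' q')) →
        y = x ∧ q = p) := by
  obtain ⟨x, p, hx, hp, hle⟩ := exists_forall_dKant_benford_le hb hr hn
  have hopt := isOptimal_of_forall_dKant_le hb hr hx hp hle
  refine ⟨x, p, hx, hp, hle, ?_, fun y q hy hq h => ?_⟩
  · have hinj : StrictMono x := fun i j hij => by
      have := hopt.values_lt hb hr (Fin.lt_def.1 hij) j.2
      rwa [xcoord_of_lt x i.2, xcoord_of_lt x j.2] at this
    rw [← image_univ, ncard_image_of_injective _ hinj.injective, ncard_univ, Nat.card_fin]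
  · have hopt' := isOptimal_of_forall_dKant_le hb hr hy hq h
    constructor
    · funext j
      have := hopt'.values_unique hopt hb hr j.2
      rwa [xcoord_of_lt y j.2, xcoord_of_lt x j.2] at this
    · funext j
      have h0 := hopt'.subdivision_unique hopt hb hr j j.2.le
      have h1 := hopt'.subdivision_unique hopt hb hr (j + 1) j.2
      rw [psum_succ q j.2, psum_succ p j.2, h0] at h1
      exact add_left_cancel h1

end BenfordApprox
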